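/- Let 0 < ε ≤ 1/8. Then the frontier of U₁ in S⁵ is exactly ∂U₁ = {A^k v : k ∈ ℕ, v ∈ ℂ³, ‖v‖ = 1, |v₂|² + |v₃|² = ε}, and the frontier of U₂ in S⁵ is ∂U₂ = {P u : u ∈ ∂U₁}. -/

import Mathlib

open Matrix

noncomputable section

/-- `ξ = exp(2πi/3)`, a primitive cube root of unity. -/
def ξ : ℂ := Complex.exp (2 * Real.pi * Complex.I / 3)

/-- The cyclic permutation matrix `A`, with rows `(0,1,0)`, `(0,0,1)`, `(1,0,0)`. -/
def A : Matrix (Fin 3) (Fin 3) ℂ := !![0, 1, 0; 0, 0, 1; 1, 0, 0]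

/-- The diagonal matrix `B = diag(1, ξ, ξ²)`. -/
def B : Matrix (Fin 3) (Fin 3) ℂ := !![1, 0, 0; 0, ξ, 0; 0, 0, ξ ^ 2]

/-- The matrix `P = (1/√3)·[[1,ξ,1],[1,1,ξ],[ξ,1,1]]`. -/
def P : Matrix (Fin 3) (Fin 3) ℂ :=
  (((Real.sqrt 3 : ℝ) : ℂ))⁻¹ • !![1, ξ, 1; 1, 1, ξ; ξ, 1, 1]

/-- Euclidean space `ℂ³`. -/
abbrev E3 := EuclideanSpace ℂ (Fin 3)

/-- Application of a `3 × 3` complex matrix to a vector in `ℂ³`. -/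
def app (M : Matrix (Fin 3) (Fin 3) ℂ) (v : E3) : E3 := Matrix.toEuclideanLin M v

/-- The unit sphere `S⁵ ⊆ ℂ³`. -/
abbrev S5 : Set E3 := Metric.sphere (0 : E3) 1

/-- The subset `U₁ = {A^k v : k ∈ ℕ, ‖v‖ = 1, |v₂|² + |v₃|² ≤ ε}` of `S⁵`. -/
def U1 (ε : ℝ) : Set S5 :=
  {w | ∃ (k : ℕ) (v : E3), ‖v‖ = 1 ∧ ‖v 1‖ ^ 2 + ‖v 2‖ ^ 2 ≤ ε ∧ (w : E3) = app (A ^ k) v}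

/-- The subset `U₂ = P · U₁` of `S⁵`. -/
def U2 (ε : ℝ) : Set S5 := {w | ∃ u ∈ U1 ε, (w : E3) = app P (u : E3)}

lemma app_A_pow_apply (k : ℕ) (v : E3) (i : Fin 3) : app (A ^ k) v i = v (i + Fin.ofNat 3 k) := by
  induction k generalizing v i with
  | zero => simp [app]
  | succ k ih =>
    have h1 : app (A ^ (k + 1)) v = app (A ^ k) (app A v) := by
      simp [app, pow_succ, Matrix.toLpLin_apply]
    have h2 : ∀ j, app A v j = v (j + 1) := by
      intro j
      fin_cases j <;> simp [app, A, Matrix.toLpLin_apply, dotProduct,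
        Fin.sum_univ_three]
    have h3 : Fin.ofNat 3 (k + 1) = Fin.ofNat 3 k + 1 := by
      ext
      simp [Fin.val_add]
    rw [h1, ih, h2, h3, add_assoc]

lemma norm_sq_eq_sum_add (v : E3) (j : Fin 3) :
    ‖v‖ ^ 2 = ‖v j‖ ^ 2 + (‖v (j + 1)‖ ^ 2 + ‖v (j + 2)‖ ^ 2) := by
  rw [EuclideanSpace.norm_sq_eq, Fin.sum_univ_three]
  fin_cases j <;> simp <;> ring

/-- A point of the sphere is `A ^ k v` with `|v₂|² + |v₃|²` in a prescribed set exactly when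
`1 - |w_j|²` lies in that set for some coordinate `w_j`. -/
lemma exists_app_A_pow_iff (p : ℝ → Prop) (w : S5) :
    (∃ (k : ℕ) (v : E3), ‖v‖ = 1 ∧ p (‖v 1‖ ^ 2 + ‖v 2‖ ^ 2) ∧ (w : E3) = app (A ^ k) v) ↔
      ∃ j, p (1 - ‖(w : E3) j‖ ^ 2) := by
  have hw : ‖(w : E3)‖ = 1 := mem_sphere_zero_iff_norm.mp w.2
  constructor
  · rintro ⟨k, v, hv, hp, hwv⟩
    refine ⟨-Fin.ofNat 3 k, ?_⟩
    have h := norm_sq_eq_sum_add v 0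
    rw [hv] at h
    rw [hwv, app_A_pow_apply, neg_add_cancel]
    convert hp using 1
    simp at h
    linarith
  · rintro ⟨j, hp⟩
    have h := norm_sq_eq_sum_add w j
    rw [hw] at h
    refine ⟨(-j).val, WithLp.toLp 2 fun i => (w : E3) (i + j), ?_, ?_, ?_⟩
    · have h' := norm_sq_eq_sum_add (WithLp.toLp 2 fun i => (w : E3) (i + j)) 0
      simp only [zero_add, add_comm (1 : Fin 3), add_comm (2 : Fin 3)] at h'
      rw [← h] at h'
      exact (pow_eq_one_iff_of_nonneg (norm_nonneg _) two_ne_zero).mp (h'.trans (one_pow 2))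
    · convert hp using 1
      simp only [add_comm (1 : Fin 3), add_comm (2 : Fin 3)]
      linarith
    · ext i
      rw [app_A_pow_apply]
      simp

lemma mem_U1_iff (ε : ℝ) (w : S5) : w ∈ U1 ε ↔ ∃ j, 1 - ‖(w : E3) j‖ ^ 2 ≤ ε :=
  exists_app_A_pow_iff (· ≤ ε) w

lemma continuous_one_sub_norm_sq (j : Fin 3) :
    Continuous fun w : S5 => 1 - ‖(w : E3) j‖ ^ 2 := by
  fun_prop

lemma isClosed_U1 (ε : ℝ) : IsClosed (U1 ε) := by
  have h : U1 ε = ⋃ j, {w : S5 | 1 - ‖(w : E3) j‖ ^ 2 ≤ ε} := by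
    ext w
    simp [mem_U1_iff]
  rw [h]
  exact isClosed_iUnion_of_finite fun j =>
    isClosed_le (continuous_one_sub_norm_sq j) continuous_const

/-- Shrinking the coordinate `w j` and renormalizing moves a boundary point out of `U₁`. -/
lemma notMem_interior_U1 {ε : ℝ} (hε0 : 0 < ε) (hε : ε ≤ 1 / 8) {w : S5} {j : Fin 3}
    (hj : 1 - ‖(w : E3) j‖ ^ 2 = ε) : w ∉ interior (U1 ε) := by
  intro hint
  have hw : ‖(w : E3)‖ = 1 := mem_sphere_zero_iff_norm.mp w.2
  obtain ⟨V, hVo, hV⟩ := isOpen_induced_iff.mp (isOpen_interior (s := U1 ε))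
  have hwV : (w : E3) ∈ V := by
    change w ∈ Subtype.val ⁻¹' V
    rwa [hV]
  let x : ℝ → E3 := fun t => (w : E3) - t • EuclideanSpace.single j ((w : E3) j)
  have hx0 : x 0 = w := by simp [x]
  have hxc : Continuous x := by fun_prop
  let y : ℝ → E3 := fun t => ‖x t‖⁻¹ • x t
  have hy0 : y 0 = w := by simp [y, hx0, hw]
  have hyc : ContinuousAt y 0 := by
    refine ContinuousAt.smul (hxc.norm.continuousAt.inv₀ ?_) hxc.continuousAt
    simp [hx0, hw]
  have hsum := norm_sq_eq_sum_add w j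
  rw [hw] at hsum
  have hsmall : ∀ i, i ≠ j → ‖(w : E3) i‖ ^ 2 < 1 - ε := by
    intro i hi
    have hij : i = j + 1 ∨ i = j + 2 := by
      clear * - hi
      decide +revert
    have h1 := sq_nonneg ‖(w : E3) (j + 1)‖
    have h2 := sq_nonneg ‖(w : E3) (j + 2)‖
    rcases hij with rfl | rfl <;> linarith
  have hev : ∀ᶠ t in nhds (0 : ℝ), y t ∈ V ∧ ∀ i, i ≠ j → ‖y t i‖ ^ 2 < 1 - ε := by
    refine (hyc.eventually (hVo.mem_nhds (by rwa [hy0]))).and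
      (Filter.eventually_all.mpr fun i => ?_)
    by_cases hi : i = j
    · simp [hi]
    · have hc : ContinuousAt (fun t => ‖y t i‖ ^ 2) 0 := by fun_prop
      filter_upwards [hc.eventually_lt continuousAt_const
        (by simpa only [hy0] using hsmall i hi)] with t ht _ using ht
  obtain ⟨t, ⟨htV, hti⟩, ht0, ht1⟩ := ((hev.filter_mono nhdsWithin_le_nhds).and
    (Ioo_mem_nhdsGT (zero_lt_one' ℝ))).exists
  have hxj : ‖x t j‖ ^ 2 = (1 - t) ^ 2 * (1 - ε) := by
    have : x t j = ((1 - t : ℝ) : ℂ) * (w : E3) j := by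
      simp [x]
      ring
    rw [this, norm_mul, mul_pow, Complex.norm_real, Real.norm_eq_abs, sq_abs]
    congr 1
    linarith
  have hxn : ‖x t‖ ^ 2 = (1 - t) ^ 2 * (1 - ε) + ε := by
    rw [norm_sq_eq_sum_add (x t) j, hxj]
    have h1 : x t (j + 1) = (w : E3) (j + 1) := by simp [x]
    have h2 : x t (j + 2) = (w : E3) (j + 2) := by simp [x]
    rw [h1, h2]
    linarith
  have hpos : 0 < ‖x t‖ ^ 2 := by
    rw [hxn]
    have : 0 ≤ (1 - t) ^ 2 * (1 - ε) := mul_nonneg (sq_nonneg _) (by linarith)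
    linarith
  have hne : ‖x t‖ ≠ 0 := fun h => by simp [h] at hpos
  have hyn : y t ∈ S5 := by
    rw [mem_sphere_zero_iff_norm]
    simp [y, norm_smul, inv_mul_cancel₀ hne]
  have hmem : (⟨y t, hyn⟩ : S5) ∈ U1 ε := by
    apply interior_subset
    rw [← hV]
    exact htV
  obtain ⟨i, hi⟩ := (mem_U1_iff ε _).mp hmem
  by_cases hij : i = j
  · subst hij
    have hyi : ‖y t i‖ ^ 2 * ‖x t‖ ^ 2 = ‖x t i‖ ^ 2 := by
      simp only [y, PiLp.smul_apply, norm_smul, norm_inv, norm_norm]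
      field_simp
    rw [hxj, hxn] at hyi
    have hsq : (1 - t) ^ 2 < 1 := by nlinarith
    rw [hxn] at hpos
    have h1 : (1 - ε) * ((1 - t) ^ 2 * (1 - ε) + ε) ≤ (1 - t) ^ 2 * (1 - ε) := by
      refine le_trans ?_ hyi.le
      exact mul_le_mul_of_nonneg_right (sub_le_comm.mp hi) hpos.le
    nlinarith [mul_pos (mul_pos hε0 (show 0 < 1 - ε by linarith)) (sub_pos.mpr hsq)]
  · linarith [hti i hij]

lemma frontier_U1 {ε : ℝ} (hε0 : 0 < ε) (hε : ε ≤ 1 / 8) :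
    frontier (U1 ε) = {w : S5 | ∃ j, 1 - ‖(w : E3) j‖ ^ 2 = ε} := by
  rw [(isClosed_U1 ε).frontier_eq]
  ext w
  constructor
  · rintro ⟨hw, hint⟩
    obtain ⟨j, hj⟩ := (mem_U1_iff ε w).mp hw
    refine ⟨j, hj.eq_of_not_lt fun hlt => hint ?_⟩
    exact mem_interior.mpr ⟨{w : S5 | 1 - ‖(w : E3) j‖ ^ 2 < ε},
      fun u hu => (mem_U1_iff ε u).mpr ⟨j, le_of_lt hu⟩,
      isOpen_lt (continuous_one_sub_norm_sq j) continuous_const, hlt⟩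
  · rintro ⟨j, hj⟩
    exact ⟨(mem_U1_iff ε w).mpr ⟨j, hj.le⟩, notMem_interior_U1 hε0 hε hj⟩

lemma app_mul (M N : Matrix (Fin 3) (Fin 3) ℂ) (v : E3) : app (M * N) v = app M (app N v) := by
  simp [app, Matrix.toLpLin_apply, Matrix.mulVec_mulVec]

lemma continuous_app (M : Matrix (Fin 3) (Fin 3) ℂ) : Continuous (app M) :=
  LinearMap.continuous_of_finiteDimensional _

lemma norm_app_of_conjTranspose_mul_self {M : Matrix (Fin 3) (Fin 3) ℂ} (hM : Mᴴ * M = 1)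
    (v : E3) : ‖app M v‖ = ‖v‖ := by
  have h : inner ℂ (app M v) (app M v) = inner ℂ v v := by
    have h1 : app Mᴴ (app M v) = v := by
      rw [← app_mul, hM]
      simp [app]
    rw [app, Matrix.toEuclideanLin_conjTranspose_eq_adjoint] at h1
    conv_rhs => rw [← h1, LinearMap.adjoint_inner_left, h1]
    rfl
  rw [inner_self_eq_norm_sq_to_K, inner_self_eq_norm_sq_to_K] at h
  exact (sq_eq_sq₀ (norm_nonneg _) (norm_nonneg _)).mp (by exact_mod_cast h)

/-- The homeomorphism of `S⁵` induced by a unitary matrix. -/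
def sphereHomeomorph (M : Matrix (Fin 3) (Fin 3) ℂ) (h₁ : Mᴴ * M = 1) (h₂ : M * Mᴴ = 1) :
    S5 ≃ₜ S5 where
  toFun w := ⟨app M w, mem_sphere_zero_iff_norm.mpr
    ((norm_app_of_conjTranspose_mul_self h₁ _).trans (mem_sphere_zero_iff_norm.mp w.2))⟩
  invFun w := ⟨app Mᴴ w, mem_sphere_zero_iff_norm.mpr
    ((norm_app_of_conjTranspose_mul_self (by rwa [conjTranspose_conjTranspose]) _).trans
      (mem_sphere_zero_iff_norm.mp w.2))⟩
  left_inv w := Subtype.ext (by simp only [← app_mul, h₁]; simp [app])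
  right_inv w := Subtype.ext (by simp only [← app_mul, h₂]; simp [app])
  continuous_toFun := ((continuous_app M).comp continuous_subtype_val).subtype_mk _
  continuous_invFun := ((continuous_app Mᴴ).comp continuous_subtype_val).subtype_mk _

lemma isPrimitiveRoot_ξ : IsPrimitiveRoot ξ 3 := Complex.isPrimitiveRoot_exp 3 (by norm_num)

lemma ξ_sq_add_ξ_add_one : ξ ^ 2 + ξ + 1 = 0 := by
  have h := isPrimitiveRoot_ξ.geom_sum_eq_zero (by norm_num)
  simp only [Finset.sum_range_succ, Finset.sum_range_zero] at h
  linear_combination h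

lemma conj_ξ : (starRingEnd ℂ) ξ = ξ ^ 2 := by
  rw [← Complex.inv_eq_conj (Complex.norm_eq_one_of_pow_eq_one isPrimitiveRoot_ξ.pow_eq_one
    (by norm_num))]
  have h := isPrimitiveRoot_ξ.pow_eq_one
  exact inv_eq_of_mul_eq_one_right (by linear_combination h)

lemma conjTranspose_P_mul_P : Pᴴ * P = 1 := by
  have h3 : (((Real.sqrt 3 : ℝ) : ℂ))⁻¹ * (((Real.sqrt 3 : ℝ) : ℂ))⁻¹ = 3⁻¹ := by
    rw [← mul_inv, ← Complex.ofReal_mul, Real.mul_self_sqrt (by norm_num)]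
    norm_num
  have hstar : star (((Real.sqrt 3 : ℝ) : ℂ))⁻¹ = (((Real.sqrt 3 : ℝ) : ℂ))⁻¹ := by simp
  have hξ := ξ_sq_add_ξ_add_one
  have hξ3 := isPrimitiveRoot_ξ.pow_eq_one
  rw [P, conjTranspose_smul, hstar, smul_mul_smul_comm, h3]
  ext i j
  fin_cases i <;> fin_cases j <;>
    simp [Matrix.mul_apply, Fin.sum_univ_three, conj_ξ] <;> grind

/-- Explicit description of the frontiers (in `S⁵`) of `U₁` and `U₂`. -/
theorem frontier_U1_U2_description (ε : ℝ) (hε0 : 0 < ε) (hε : ε ≤ 1 / 8) :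
    frontier (U1 ε) =
      {w : S5 | ∃ (k : ℕ) (v : E3), ‖v‖ = 1 ∧ ‖v 1‖ ^ 2 + ‖v 2‖ ^ 2 = ε ∧
        (w : E3) = app (A ^ k) v} ∧
    frontier (U2 ε) = {w : S5 | ∃ u ∈ frontier (U1 ε), (w : E3) = app P (u : E3)} := by
  refine ⟨?_, ?_⟩
  · rw [frontier_U1 hε0 hε]
    ext w
    exact (exists_app_A_pow_iff (· = ε) w).symm
  · let Φ := sphereHomeomorph P conjTranspose_P_mul_P
      (mul_eq_one_comm.mp conjTranspose_P_mul_P)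
    have himage : ∀ s : Set S5, {w : S5 | ∃ u ∈ s, (w : E3) = app P (u : E3)} = Φ '' s := by
      intro s
      ext w
      exact exists_congr fun u => and_congr_right fun _ =>
        eq_comm.trans (Subtype.ext_iff (a1 := Φ u) (a2 := w)).symm
    rw [himage, Φ.image_frontier, ← himage]
    rfl
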